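/- arXiv:1112.4122 — 4 statements merged into one kernel-verified Lean document; each statement's English description precedes it below -/
import Mathlib

section
/- Let a < b be real numbers, let r be a positive continuous function on the interval (a,b), and let p be a positive integer. Then for every nonnegative measurable function f on (a,b) for which all the integrals below exist and are finite, ∫_a^b r(x)(∫_a^x f(t) dt)^{p+1} dx ≤ (b−a)^p · sup_{a<x<b} (∫_x^b r(t) dt) · ∫_a^b f(x)^{p+1} dx. -/
open MeasureTheory intervalIntegral Set

/-- Jensen's inequality for the power function on an interval. -/
theorem pow_integral_le_mul_integral_pow {a b : ℝ} (hab : a < b) (p : ℕ) {f : ℝ → ℝ}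
    (hf : ∀ x ∈ Ioo a b, 0 ≤ f x) (hfi : IntervalIntegrable f volume a b)
    (hfp : IntervalIntegrable (fun x => f x ^ (p + 1)) volume a b) :
    (∫ x in a..b, f x) ^ (p + 1) ≤ (b - a) ^ p * ∫ x in a..b, f x ^ (p + 1) := by
  have hba : 0 < b - a := sub_pos.2 hab
  have hjensen := (convexOn_pow (𝕜 := ℝ) (p + 1)).map_set_average_le
    (continuous_pow (p + 1)).continuousOn isClosed_Ici
    (μ := volume) (t := Ioo a b) (f := f) (by simp [hab]) (by simp)
    ((ae_restrict_iff' measurableSet_Ioo).2 (Filter.Eventually.of_forall hf))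
    ((intervalIntegrable_iff_integrableOn_Ioo_of_le hab.le).1 hfi)
    ((intervalIntegrable_iff_integrableOn_Ioo_of_le hab.le).1 hfp)
  simp only [setAverage_eq, smul_eq_mul, Real.volume_real_Ioo_of_le hab.le,
    ← integral_Ioc_eq_integral_Ioo, ← integral_of_le hab.le] at hjensen
  rw [mul_pow, inv_pow, inv_mul_le_iff₀ (by positivity)] at hjensen
  refine hjensen.trans_eq ?_
  field_simp
  ring

/-- The supremum of the tail integrals of an integrable function is at least its integral. -/
theorem integral_le_sSup_tail_integral {a b : ℝ} (hab : a < b) {r : ℝ → ℝ}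
    (hri : IntervalIntegrable r volume a b) :
    ∫ t in a..b, r t ≤ sSup ((fun x => ∫ t in x..b, r t) '' Ioo a b) := by
  have hcont : ContinuousOn (fun x => ∫ t in x..b, r t) (Icc a b) := by
    rw [← uIcc_of_le hab.le]
    exact continuousOn_primitive_interval_left
      ((intervalIntegrable_iff' (by simp)).1 hri)
  have hbdd : BddAbove ((fun x => ∫ t in x..b, r t) '' Ioo a b) :=
    (isCompact_Icc.bddAbove_image hcont).mono (image_mono Ioo_subset_Icc_self)
  have hmaps : MapsTo (fun x => ∫ t in x..b, r t) (Ioo a b)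
      (Iic (sSup ((fun x => ∫ t in x..b, r t) '' Ioo a b))) :=
    fun x hx => le_csSup hbdd (mem_image_of_mem _ hx)
  have hclosure := hmaps.closure_of_continuousOn (by rwa [closure_Ioo hab.ne])
  rw [closure_Ioo hab.ne, isClosed_Iic.closure_eq] at hclosure
  exact hclosure (left_mem_Icc.2 hab.le)

/-- Theorem 2.11: For positive continuous `r` on `(a,b)`, a positive integer `p`,
and nonnegative measurable `f` (all integrals existing and finite),
`∫_a^b r(x)(∫_a^x f)^(p+1) dx ≤ (b−a)^p · sup_{a<x<b} (∫_x^b r) · ∫_a^b f^(p+1)`. -/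
theorem hardy_type_thm_2_11 (a b : ℝ) (hab : a < b) (p : ℕ) (hp : 0 < p) (r f : ℝ → ℝ)
    (hr : ContinuousOn r (Ioo a b)) (hrpos : ∀ x ∈ Ioo a b, 0 < r x)
    (hfmeas : Measurable f) (hfnonneg : ∀ x ∈ Ioo a b, 0 ≤ f x)
    (hfi : IntervalIntegrable f volume a b)
    (hri : IntervalIntegrable r volume a b)
    (h1 : IntervalIntegrable (fun x => r x * (∫ t in a..x, f t) ^ (p + 1)) volume a b)
    (h2 : IntervalIntegrable (fun x => f x ^ (p + 1)) volume a b) :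
    ∫ x in a..b, r x * (∫ t in a..x, f t) ^ (p + 1) ≤
      (b - a) ^ p * sSup ((fun x => ∫ t in x..b, r t) '' Ioo a b) *
        ∫ x in a..b, f x ^ (p + 1) := by
  have hba : 0 < b - a := sub_pos.2 hab
  have hfp_nonneg : 0 ≤ ∫ x in a..b, f x ^ (p + 1) := by
    rw [integral_of_le hab.le, integral_Ioc_eq_integral_Ioo]
    exact setIntegral_nonneg measurableSet_Ioo fun x hx => pow_nonneg (hfnonneg x hx) _
  have hf_ae : ∀ᵐ x ∂volume.restrict (Ioc a b), 0 ≤ f x := by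
    rw [← restrict_Ioo_eq_restrict_Ioc]
    exact (ae_restrict_iff' measurableSet_Ioo).2 (Filter.Eventually.of_forall hfnonneg)
  have hpow : ∀ x ∈ Ioo a b, (∫ t in a..x, f t) ^ (p + 1) ≤
      (b - a) ^ p * ∫ t in a..b, f t ^ (p + 1) := by
    intro x hx
    have hx_nonneg : 0 ≤ ∫ t in a..x, f t :=
      integral_nonneg_of_ae_restrict hx.1.le
        ((ae_restrict_of_ae_restrict_of_subset (Icc_subset_Icc_right hx.2.le))
          (by rwa [← restrict_Ioc_eq_restrict_Icc]))
    have hmono : ∫ t in a..x, f t ≤ ∫ t in a..b, f t :=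
      integral_mono_interval le_rfl hx.1.le hx.2.le hf_ae hfi
    exact (pow_le_pow_left₀ hx_nonneg hmono _).trans
      (pow_integral_le_mul_integral_pow hab p hfnonneg hfi h2)
  calc ∫ x in a..b, r x * (∫ t in a..x, f t) ^ (p + 1)
      ≤ ∫ x in a..b, r x * ((b - a) ^ p * ∫ t in a..b, f t ^ (p + 1)) :=
        integral_mono_on_of_le_Ioo hab.le h1 (hri.mul_const _) fun x hx =>
          mul_le_mul_of_nonneg_left (hpow x hx) (hrpos x hx).le
    _ = (∫ x in a..b, r x) * ((b - a) ^ p * ∫ t in a..b, f t ^ (p + 1)) :=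
        intervalIntegral.integral_mul_const _ _
    _ ≤ sSup ((fun x => ∫ t in x..b, r t) '' Ioo a b) *
          ((b - a) ^ p * ∫ t in a..b, f t ^ (p + 1)) :=
        mul_le_mul_of_nonneg_right (integral_le_sSup_tail_integral hab hri) (by positivity)
    _ = _ := by ring
end

section
/- Let a < b be real numbers, let r and s be positive continuous functions on the interval (a,b), and let p be a positive integer, with ∫_a^b s(x)^{−1/p} dx < ∞. Then for every nonnegative measurable function f on (a,b) for which all the integrals below exist and are finite, ∫_a^b r(x)(∫_x^b f(t) dt)^{p+1} dx ≤ C · ∫_a^b s(x) f(x)^{p+1} dx, where C = sup_{a<x<b} (∫_a^x r(t) dt) · (∫_a^b s(x)^{−1/p} dx)^p. -/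
open MeasureTheory intervalIntegral Set

/-- The graph of `t ↦ t ^ (n + 1)` lies above its tangent at `c`. -/
lemma tangent_le_pow_succ (n : ℕ) {t c : ℝ} (ht : 0 ≤ t) (hc : 0 ≤ c) :
    (n + 1) * c ^ n * t - n * c ^ (n + 1) ≤ t ^ (n + 1) := by
  induction n with
  | zero => simp
  | succ n ih =>
    have h := mul_le_mul_of_nonneg_left ih ht
    have hsq : 0 ≤ (n + 1) * c ^ n * (t - c) ^ 2 := by positivity
    push_cast
    calc _ ≤ t * ((n + 1) * c ^ n * t - n * c ^ (n + 1)) := by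
          linear_combination hsq
      _ ≤ t * t ^ (n + 1) := h
      _ = t ^ (n + 1 + 1) := by ring

/-- Hölder's inequality with weight `s`, for the exponents `p + 1` and `(p + 1) / p`. -/
lemma integral_pow_succ_le_weighted {a b : ℝ} (hab : a < b) {p : ℕ} (hp : 0 < p) {s f : ℝ → ℝ}
    (hspos : ∀ x ∈ Ioo a b, 0 < s x)
    (hsint : IntervalIntegrable (fun x => s x ^ (-(1 : ℝ) / p)) volume a b)
    (hfnonneg : ∀ x ∈ Ioo a b, 0 ≤ f x) (hfi : IntervalIntegrable f volume a b)
    (hsf : IntervalIntegrable (fun x => s x * f x ^ (p + 1)) volume a b) :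
    (∫ x in a..b, f x) ^ (p + 1) ≤
      (∫ x in a..b, s x ^ (-(1 : ℝ) / p)) ^ p * ∫ x in a..b, s x * f x ^ (p + 1) := by
  set F := ∫ x in a..b, f x with hF
  set G := ∫ x in a..b, s x ^ (-(1 : ℝ) / p) with hG
  have hGpos : 0 < G :=
    intervalIntegral_pos_of_pos_on hsint (fun x hx => Real.rpow_pos_of_pos (hspos x hx) _) hab
  have hFnonneg : 0 ≤ F := by
    simpa using integral_mono_on_of_le_Ioo hab.le intervalIntegrable_const hfi hfnonneg
  set c := F / G
  have hcnonneg : 0 ≤ c := by positivity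
  have hpointwise : ∀ x ∈ Ioo a b,
      (p + 1) * c ^ p * f x - p * c ^ (p + 1) * s x ^ (-(1 : ℝ) / p) ≤ s x * f x ^ (p + 1) := by
    intro x hx
    have hg : 0 < s x ^ (-(1 : ℝ) / p) := Real.rpow_pos_of_pos (hspos x hx) _
    have hsg : s x * (s x ^ (-(1 : ℝ) / p)) ^ p = 1 := by
      rw [← Real.rpow_natCast, ← Real.rpow_mul (hspos x hx).le,
        div_mul_cancel₀ _ (by positivity), Real.rpow_neg_one, mul_inv_cancel₀ (hspos x hx).ne']
    set g := s x ^ (-(1 : ℝ) / p)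
    have h := mul_le_mul_of_nonneg_left
      (tangent_le_pow_succ p (div_nonneg (hfnonneg x hx) hg.le) hcnonneg) hg.le
    have hs : s x = 1 / g ^ p := by field_simp; exact hsg
    calc _ = g * ((p + 1) * c ^ p * (f x / g) - p * c ^ (p + 1)) := by field_simp
      _ ≤ g * (f x / g) ^ (p + 1) := h
      _ = s x * f x ^ (p + 1) := by rw [hs, div_pow]; field_simp; ring
  have hmono := integral_mono_on_of_le_Ioo hab.le
    ((hfi.const_mul _).sub (hsint.const_mul _)) hsf hpointwise
  rw [integral_sub (hfi.const_mul _) (hsint.const_mul _),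
    intervalIntegral.integral_const_mul, intervalIntegral.integral_const_mul, ← hF, ← hG] at hmono
  calc F ^ (p + 1) = G ^ p * ((p + 1) * c ^ p * F - p * c ^ (p + 1) * G) := by
        have hFc : F = c * G := (div_mul_cancel₀ F hGpos.ne').symm
        rw [hFc]; ring
    _ ≤ _ := by gcongr

/-- The full integral of an integrable function is at most the supremum of its primitive. -/
lemma integral_le_sSup_primitive {a b : ℝ} (hab : a < b) {r : ℝ → ℝ}
    (hri : IntervalIntegrable r volume a b) :
    ∫ x in a..b, r x ≤ sSup ((fun x => ∫ t in a..x, r t) '' Ioo a b) := by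
  have hcont : ContinuousOn (fun x => ∫ t in a..x, r t) (Icc a b) := by
    simpa [uIcc_of_le hab.le] using continuousOn_primitive_interval' hri left_mem_uIcc
  have hbdd : BddAbove ((fun x => ∫ t in a..x, r t) '' Ioo a b) :=
    (isCompact_Icc.bddAbove_image hcont).mono (image_mono Ioo_subset_Icc_self)
  have htend : Filter.Tendsto (fun x => ∫ t in a..x, r t) (nhdsWithin b (Ioo a b))
      (nhds (∫ t in a..b, r t)) :=
    (hcont b (right_mem_Icc.2 hab.le)).mono_left (nhdsWithin_mono _ Ioo_subset_Icc_self)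
  rw [nhdsWithin_Ioo_eq_nhdsLT hab] at htend
  refine le_of_tendsto htend ?_
  filter_upwards [Ioo_mem_nhdsLT hab] with x hx
  exact le_csSup hbdd (mem_image_of_mem _ hx)

/-- Theorem 2.15: For positive continuous `r, s` on `(a,b)`, a positive integer `p`,
with `∫_a^b s(x)^(−1/p) dx < ∞`, and nonnegative measurable `f` (all integrals
existing and finite), `∫_a^b r(x)(∫_x^b f)^(p+1) dx ≤ C · ∫_a^b s(x) f(x)^(p+1) dx`,
where `C = sup_{a<x<b} (∫_a^x r) · (∫_a^b s^(−1/p))^p`. -/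
theorem hardy_type_thm_2_15 (a b : ℝ) (hab : a < b) (p : ℕ) (hp : 0 < p) (r s f : ℝ → ℝ)
    (hr : ContinuousOn r (Ioo a b)) (hrpos : ∀ x ∈ Ioo a b, 0 < r x)
    (hs : ContinuousOn s (Ioo a b)) (hspos : ∀ x ∈ Ioo a b, 0 < s x)
    (hsint : IntervalIntegrable (fun x => s x ^ (-(1 : ℝ) / p)) volume a b)
    (hfmeas : Measurable f) (hfnonneg : ∀ x ∈ Ioo a b, 0 ≤ f x)
    (hfi : IntervalIntegrable f volume a b)
    (hri : IntervalIntegrable r volume a b)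
    (h1 : IntervalIntegrable (fun x => r x * (∫ t in x..b, f t) ^ (p + 1)) volume a b)
    (h2 : IntervalIntegrable (fun x => s x * f x ^ (p + 1)) volume a b) :
    ∫ x in a..b, r x * (∫ t in x..b, f t) ^ (p + 1) ≤
      (sSup ((fun x => ∫ t in a..x, r t) '' Ioo a b) *
          (∫ x in a..b, s x ^ (-(1 : ℝ) / p)) ^ p) *
        ∫ x in a..b, s x * f x ^ (p + 1) := by
  have htail : ∀ x ∈ Ioo a b,
      0 ≤ ∫ t in x..b, f t ∧ ∫ t in x..b, f t ≤ ∫ t in a..b, f t := by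
    intro x hx
    have hsub₁ : IntervalIntegrable f volume a x :=
      hfi.mono_set (uIcc_subset_uIcc left_mem_uIcc (mem_uIcc_of_le hx.1.le hx.2.le))
    have hsub₂ : IntervalIntegrable f volume x b :=
      hfi.mono_set (uIcc_subset_uIcc (mem_uIcc_of_le hx.1.le hx.2.le) right_mem_uIcc)
    have hhead : 0 ≤ ∫ t in a..x, f t := by
      simpa using integral_mono_on_of_le_Ioo hx.1.le intervalIntegrable_const hsub₁
        fun t ht => hfnonneg t ⟨ht.1, ht.2.trans hx.2⟩
    have htail : 0 ≤ ∫ t in x..b, f t := by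
      simpa using integral_mono_on_of_le_Ioo hx.2.le intervalIntegrable_const hsub₂
        fun t ht => hfnonneg t ⟨hx.1.trans ht.1, ht.2⟩
    refine ⟨htail, ?_⟩
    linarith [integral_add_adjacent_intervals hsub₁ hsub₂]
  have hrnonneg : 0 ≤ ∫ x in a..b, r x := (intervalIntegral_pos_of_pos_on hri hrpos hab).le
  have hholder := integral_pow_succ_le_weighted hab hp hspos hsint hfnonneg hfi h2
  have hFnonneg : 0 ≤ ∫ x in a..b, f x := by
    simpa using integral_mono_on_of_le_Ioo hab.le intervalIntegrable_const hfi hfnonneg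
  have hsup := integral_le_sSup_primitive hab hri
  calc ∫ x in a..b, r x * (∫ t in x..b, f t) ^ (p + 1)
      ≤ ∫ x in a..b, r x * (∫ t in a..b, f t) ^ (p + 1) :=
        integral_mono_on_of_le_Ioo hab.le h1 (hri.mul_const _) fun x hx =>
          mul_le_mul_of_nonneg_left (pow_le_pow_left₀ (htail x hx).1 (htail x hx).2 _)
            (hrpos x hx).le
    _ = (∫ x in a..b, r x) * (∫ t in a..b, f t) ^ (p + 1) := intervalIntegral.integral_mul_const _ _
    _ ≤ _ := by
        rw [mul_assoc]
        exact mul_le_mul hsup hholder (by positivity) (hrnonneg.trans hsup)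
end

section
/- Let a < b be real numbers, let r be a positive continuous function on the interval (a,b), and let p > 1 be an integer (with conjugate exponent q = p/(p−1)). Then for every nonnegative measurable function f on (a,b) for which all the integrals below exist and are finite, ∫_a^b r(x)(∫_x^b f(t) dt)^{p+1} dx ≤ C · (∫_a^b f(x)^{p(p+1)/(p−1)} dx)^{(p−1)/p}, where C = (p+1)^{1/p} (b−a)^p (∫_a^b R(a,x)^p dx)^{1/p}. -/
open MeasureTheory intervalIntegral Set

/-- The tail primitive of an interval integrable function is absolutely continuous. -/
theorem absolutelyContinuousOnInterval_integral_tail {f : ℝ → ℝ} {a b : ℝ}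
    (hf : IntervalIntegrable f volume a b) :
    AbsolutelyContinuousOnInterval (fun x => ∫ t in x..b, f t) a b := by
  have h := (hf.absolutelyContinuousOnInterval_intervalIntegral (c := b) right_mem_uIcc).const_mul
    (-1)
  have e : (fun x => ∫ t in x..b, f t) = fun x => -1 * ∫ t in b..x, f t := by
    funext x
    rw [integral_symm]
    ring
  rwa [e]

theorem AbsolutelyContinuousOnInterval.fun_pow_nat {F : ℝ → ℝ} {a b : ℝ}
    (hF : AbsolutelyContinuousOnInterval F a b) (n : ℕ) :
    AbsolutelyContinuousOnInterval (fun x => F x ^ (n + 1)) a b := by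
  induction n with
  | zero => simpa using hF
  | succ n ih =>
    have := ih.fun_mul hF
    simpa only [pow_succ] using this

/-- Almost everywhere derivative of a power of the tail primitive. -/
theorem ae_deriv_integral_tail_pow {f : ℝ → ℝ} {a b : ℝ}
    (hf : IntervalIntegrable f volume a b) (n : ℕ) :
    ∀ᵐ x, x ∈ uIcc a b → deriv (fun x => (∫ t in x..b, f t) ^ (n + 1)) x =
      -((n + 1) * ((∫ t in x..b, f t) ^ n * f x)) := by
  filter_upwards [hf.ae_hasDerivAt_integral] with x hx hxm
  have h := hx hxm b right_mem_uIcc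
  have h' : HasDerivAt (fun x => ∫ t in x..b, f t) (-f x) x := by
    have e : (fun x => ∫ t in x..b, f t) = fun x => -∫ t in b..x, f t := by
      funext y
      rw [integral_symm]
    rw [e]
    exact h.fun_neg
  rw [(h'.fun_pow (n + 1)).deriv]
  push_cast
  ring

theorem integral_mul_integral_tail_pow {r f : ℝ → ℝ} {a b : ℝ}
    (hr : IntervalIntegrable r volume a b) (hf : IntervalIntegrable f volume a b) (n : ℕ) :
    ∫ x in a..b, r x * (∫ t in x..b, f t) ^ (n + 1) =
      (n + 1) * ∫ x in a..b, (∫ t in a..x, r t) * ((∫ t in x..b, f t) ^ n * f x) := by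
  have hR := hr.absolutelyContinuousOnInterval_intervalIntegral (c := a) left_mem_uIcc
  have hF := (absolutelyContinuousOnInterval_integral_tail hf).fun_pow_nat n
  have key := hR.integral_mul_deriv_eq_deriv_mul hF
  have e1 : ∫ x in a..b, (∫ t in a..x, r t) *
        deriv (fun x => (∫ t in x..b, f t) ^ (n + 1)) x =
      ∫ x in a..b, -((n + 1 : ℝ)) * ((∫ t in a..x, r t) * ((∫ t in x..b, f t) ^ n * f x)) := by
    refine integral_congr_ae ?_
    filter_upwards [ae_deriv_integral_tail_pow hf n] with x hx hxm
    rw [hx (uIoc_subset_uIcc hxm)]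
    ring
  have e2 : ∫ x in a..b, deriv (fun x => ∫ t in a..x, r t) x * (∫ t in x..b, f t) ^ (n + 1) =
      ∫ x in a..b, r x * (∫ t in x..b, f t) ^ (n + 1) := by
    refine integral_congr_ae ?_
    filter_upwards [hr.ae_hasDerivAt_integral] with x hx hxm
    rw [(hx (uIoc_subset_uIcc hxm) a left_mem_uIcc).deriv]
  rw [e1, e2, intervalIntegral.integral_const_mul] at key
  simp only [integral_same, ne_eq, Nat.succ_ne_zero, not_false_eq_true, zero_pow, mul_zero,
    zero_mul, sub_zero, zero_sub] at key
  linarith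

theorem integral_integral_tail_pow_mul {g : ℝ → ℝ} {a b : ℝ}
    (hg : IntervalIntegrable g volume a b) (n : ℕ) :
    (n + 1) * ∫ x in a..b, (∫ t in x..b, g t) ^ n * g x = (∫ t in a..b, g t) ^ (n + 1) := by
  have key :=
    ((absolutelyContinuousOnInterval_integral_tail hg).fun_pow_nat n).integral_deriv_eq_sub
  have e1 : ∫ x in a..b, deriv (fun x => (∫ t in x..b, g t) ^ (n + 1)) x =
      ∫ x in a..b, -((n + 1 : ℝ)) * ((∫ t in x..b, g t) ^ n * g x) := by
    refine integral_congr_ae ?_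
    filter_upwards [ae_deriv_integral_tail_pow hg n] with x hx hxm
    rw [hx (uIoc_subset_uIcc hxm)]
    ring
  rw [e1, intervalIntegral.integral_const_mul] at key
  simp only [integral_same, ne_eq, Nat.succ_ne_zero, not_false_eq_true, zero_pow, zero_sub] at key
  linarith

/-- Power mean inequality on an interval. -/
theorem rpow_intervalIntegral_le {f : ℝ → ℝ} {a b q : ℝ} (hab : a ≤ b) (hq : 1 ≤ q)
    (hf0 : 0 ≤ᵐ[volume.restrict (Ioc a b)] f) (hf : IntervalIntegrable f volume a b)
    (hfq : IntervalIntegrable (fun x => f x ^ q) volume a b) :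
    (∫ x in a..b, f x) ^ q ≤ (b - a) ^ (q - 1) * ∫ x in a..b, f x ^ q := by
  rcases hab.eq_or_lt with rfl | hlt
  · simp [Real.zero_rpow (by linarith : q ≠ 0)]
  have hd : 0 < b - a := sub_pos.2 hlt
  rw [intervalIntegrable_iff_integrableOn_Ioc_of_le hab] at hf hfq
  have : NeZero (volume.restrict (Ioc a b)) := ⟨by
    rw [Ne, Measure.restrict_eq_zero]
    simp [hlt]⟩
  have J := (convexOn_rpow hq).map_average_le
    (continuousOn_id.rpow_const fun x _ => Or.inr (by linarith)) isClosed_Ici hf0 hf hfq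
  rw [setAverage_eq, setAverage_eq, ← integral_of_le hab, ← integral_of_le hab,
    Real.volume_real_Ioc_of_le hab, smul_eq_mul, smul_eq_mul] at J
  have hI : 0 ≤ ∫ x in a..b, f x := by
    rw [integral_of_le hab]
    exact integral_nonneg_of_ae hf0
  rw [Real.mul_rpow (by positivity) hI, Real.inv_rpow hd.le] at J
  rw [Real.rpow_sub_one hd.ne', div_eq_mul_inv, mul_assoc]
  calc (∫ x in a..b, f x) ^ q
      = (b - a) ^ q * (((b - a) ^ q)⁻¹ * (∫ x in a..b, f x) ^ q) := by
        rw [mul_inv_cancel_left₀ (by positivity)]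
    _ ≤ _ := by gcongr

/-- A higher power of a nonnegative function being integrable, so are the lower powers. -/
theorem IntervalIntegrable.rpow_of_le {f : ℝ → ℝ} {a b q s : ℝ} (hab : a ≤ b) (hq : 0 ≤ q)
    (hqs : q ≤ s) (hf0 : 0 ≤ᵐ[volume.restrict (Ioc a b)] f)
    (hf : IntervalIntegrable f volume a b)
    (hs : IntervalIntegrable (fun x => f x ^ s) volume a b) :
    IntervalIntegrable (fun x => f x ^ q) volume a b := by
  rw [intervalIntegrable_iff_integrableOn_Ioc_of_le hab] at hf hs ⊢
  refine Integrable.mono' ((integrable_const (1 : ℝ)).add hs)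
    (hf.aemeasurable.pow_const q).aestronglyMeasurable ?_
  filter_upwards [hf0] with x hx
  have hx' : 0 ≤ f x := hx
  rw [Real.norm_of_nonneg (Real.rpow_nonneg hx' q)]
  simp only [Pi.add_apply]
  rcases le_total (f x) 1 with h | h
  · linarith [Real.rpow_le_one hx' h hq, Real.rpow_nonneg hx' s]
  · linarith [Real.rpow_le_rpow_of_exponent_le h hqs]

theorem intervalIntegral_tail_nonneg {f : ℝ → ℝ} {a b x : ℝ} (hx : x ∈ Icc a b)
    (hf0 : 0 ≤ᵐ[volume.restrict (Ioc a b)] f) : 0 ≤ ∫ t in x..b, f t := by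
  rw [integral_of_le hx.2]
  exact integral_nonneg_of_ae
    (ae_restrict_of_ae_restrict_of_subset (Ioc_subset_Ioc_left hx.1) hf0)

theorem intervalIntegrable_integral_tail_pow_mul_rpow {f : ℝ → ℝ} {a b q : ℝ} {n : ℕ}
    (hab : a ≤ b) (hq : 0 ≤ q) (hf0 : 0 ≤ᵐ[volume.restrict (Ioc a b)] f)
    (hf : IntervalIntegrable f volume a b)
    (hfq : IntervalIntegrable (fun x => f x ^ q) volume a b) :
    IntervalIntegrable (fun x => ((∫ t in x..b, f t) ^ n * f x) ^ q) volume a b := by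
  have hF := (absolutelyContinuousOnInterval_integral_tail hf).continuousOn
  refine (hfq.continuousOn_mul ((hF.pow n).rpow_const fun _ _ => Or.inr hq)).congr_ae ?_
  rw [uIoc_of_le hab]
  filter_upwards [hf0, ae_restrict_mem measurableSet_Ioc] with x hx hxm
  exact (Real.mul_rpow
    (pow_nonneg (intervalIntegral_tail_nonneg (Ioc_subset_Icc_self hxm) hf0) n) hx).symm

/-- An Opial–Yang type inequality. -/
theorem integral_integral_tail_pow_mul_rpow_le {f : ℝ → ℝ} {a b q : ℝ} {n : ℕ} (hab : a < b)
    (hq : 1 ≤ q) (hf0 : 0 ≤ᵐ[volume.restrict (Ioc a b)] f)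
    (hf : IntervalIntegrable f volume a b)
    (hs : IntervalIntegrable (fun x => f x ^ (q * (n + 1))) volume a b) :
    (n + 1) * ∫ x in a..b, ((∫ t in x..b, f t) ^ n * f x) ^ q ≤
      (b - a) ^ (n * q) * ∫ x in a..b, f x ^ (q * (n + 1)) := by
  have hq0 : 0 ≤ q := by linarith
  have hd : 0 < b - a := sub_pos.2 hab
  have hn : (0 : ℝ) ≤ n := n.cast_nonneg
  have hfq := hf.rpow_of_le hab.le hq0 (by nlinarith) hf0 hs
  have hg0 : 0 ≤ᵐ[volume.restrict (Ioc a b)] fun x => f x ^ q := by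
    filter_upwards [hf0] with x hx using Real.rpow_nonneg hx q
  have hgs : (fun x => (f x ^ q) ^ ((n : ℝ) + 1)) =ᵐ[volume.restrict (Ioc a b)]
      fun x => f x ^ (q * (n + 1)) := by
    filter_upwards [hf0] with x hx using (Real.rpow_mul hx _ _).symm
  have hG := (absolutelyContinuousOnInterval_integral_tail hfq).continuousOn
  have pt : ∫ x in a..b, ((∫ t in x..b, f t) ^ n * f x) ^ q ≤
      ∫ x in a..b, (b - a) ^ ((q - 1) * n) * ((∫ t in x..b, f t ^ q) ^ n * f x ^ q) := by
    refine integral_mono_ae_restrict hab.le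
      (intervalIntegrable_integral_tail_pow_mul_rpow hab.le hq0 hf0 hf hfq)
      ((hfq.continuousOn_mul (hG.pow n)).const_mul _) ?_
    rw [restrict_Ioc_eq_restrict_Icc.symm]
    filter_upwards [hf0, ae_restrict_mem measurableSet_Ioc] with x hx hxm
    have hxm' := Ioc_subset_Icc_self hxm
    have hF0 := intervalIntegral_tail_nonneg hxm' hf0
    have hsub : uIcc x b ⊆ uIcc a b := by
      rw [uIcc_of_le hxm.2, uIcc_of_le hab.le]
      exact Icc_subset_Icc_left hxm.1.le
    have h := rpow_intervalIntegral_le hxm.2 hq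
      (ae_restrict_of_ae_restrict_of_subset (Ioc_subset_Ioc_left hxm.1.le) hf0)
      (hf.mono_set hsub) (hfq.mono_set hsub)
    have hG0 := intervalIntegral_tail_nonneg hxm' hg0
    have h2 : (∫ t in x..b, f t) ^ q ≤ (b - a) ^ (q - 1) * ∫ t in x..b, f t ^ q :=
      h.trans (mul_le_mul_of_nonneg_right
        (Real.rpow_le_rpow (sub_nonneg.2 hxm.2) (by linarith [hxm.1]) (by linarith)) hG0)
    rw [Real.mul_rpow (pow_nonneg hF0 n) hx, ← Real.rpow_natCast_mul hF0, mul_comm (n : ℝ) q,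
      Real.rpow_mul_natCast hF0, Real.rpow_mul_natCast hd.le, ← mul_assoc, ← mul_pow]
    exact mul_le_mul_of_nonneg_right (pow_le_pow_left₀ (Real.rpow_nonneg hF0 q) h2 n)
      (Real.rpow_nonneg hx q)
  have hIoc : ∫ x in a..b, (f x ^ q) ^ ((n : ℝ) + 1) = ∫ x in a..b, f x ^ (q * (n + 1)) := by
    rw [integral_of_le hab.le, integral_of_le hab.le]
    exact MeasureTheory.integral_congr_ae hgs
  have h3 := rpow_intervalIntegral_le hab.le (by linarith : 1 ≤ (n : ℝ) + 1) hg0 hfq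
    (hs.congr_ae (by rw [uIoc_of_le hab.le]; exact hgs.symm))
  rw [hIoc, add_sub_cancel_right] at h3
  have h4 := integral_integral_tail_pow_mul hfq n
  rw [← Real.rpow_natCast] at h4
  push_cast at h4
  rw [intervalIntegral.integral_const_mul] at pt
  calc (n + 1) * ∫ x in a..b, ((∫ t in x..b, f t) ^ n * f x) ^ q
      ≤ (n + 1) * ((b - a) ^ ((q - 1) * n) *
          ∫ x in a..b, (∫ t in x..b, f t ^ q) ^ n * f x ^ q) := by gcongr
    _ = (b - a) ^ ((q - 1) * n) * (∫ x in a..b, f x ^ q) ^ ((n : ℝ) + 1) := by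
        rw [← h4]; ring
    _ ≤ (b - a) ^ ((q - 1) * n) * ((b - a) ^ (n : ℝ) * ∫ x in a..b, f x ^ (q * (n + 1))) := by
        gcongr
    _ = _ := by
        rw [← mul_assoc, ← Real.rpow_add hd]
        congr 2
        ring

theorem MeasureTheory.memLp_ofReal_of_integrable_rpow {α : Type*} {m : MeasurableSpace α}
    {μ : Measure α} {f : α → ℝ} {q : ℝ} (hq : 0 < q) (hf : AEStronglyMeasurable f μ)
    (hf0 : 0 ≤ᵐ[μ] f) (hfq : Integrable (fun x => f x ^ q) μ) :
    MemLp f (ENNReal.ofReal q) μ := by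
  rw [← integrable_norm_rpow_iff hf (by simpa using hq) ENNReal.ofReal_ne_top,
    ENNReal.toReal_ofReal hq.le]
  refine hfq.congr ?_
  filter_upwards [hf0] with x hx
  rw [Real.norm_of_nonneg hx]

/-- Theorem 2.17: For positive continuous `r` on `(a,b)`, an integer `p > 1`, and
nonnegative measurable `f` (all integrals existing and finite),
`∫_a^b r(x)(∫_x^b f)^(p+1) dx ≤ C · (∫_a^b f^(p(p+1)/(p−1)))^((p−1)/p)`, where
`C = (p+1)^(1/p) (b−a)^p (∫_a^b R(a,x)^p dx)^(1/p)` and `R(a,x) = ∫_a^x r(t) dt`. -/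
theorem hardy_type_thm_2_17 (a b : ℝ) (hab : a < b) (p : ℕ) (hp : 1 < p) (r f : ℝ → ℝ)
    (hr : ContinuousOn r (Ioo a b)) (hrpos : ∀ x ∈ Ioo a b, 0 < r x)
    (hfmeas : Measurable f) (hfnonneg : ∀ x ∈ Ioo a b, 0 ≤ f x)
    (hfi : IntervalIntegrable f volume a b)
    (hri : IntervalIntegrable r volume a b)
    (h1 : IntervalIntegrable (fun x => r x * (∫ t in x..b, f t) ^ (p + 1)) volume a b)
    (h2 : IntervalIntegrable (fun x => (∫ t in a..x, r t) ^ p) volume a b)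
    (h3 : IntervalIntegrable
      (fun x => f x ^ (((p : ℝ) * ((p : ℝ) + 1)) / ((p : ℝ) - 1))) volume a b) :
    ∫ x in a..b, r x * (∫ t in x..b, f t) ^ (p + 1) ≤
      (((p : ℝ) + 1) ^ ((1 : ℝ) / p) * (b - a) ^ p *
          (∫ x in a..b, (∫ t in a..x, r t) ^ p) ^ ((1 : ℝ) / p)) *
        (∫ x in a..b, f x ^ (((p : ℝ) * ((p : ℝ) + 1)) / ((p : ℝ) - 1))) ^
          (((p : ℝ) - 1) / p) := by
  have hp0 : (0 : ℝ) < p := by positivity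
  have hp1 : (1 : ℝ) < p := by exact_mod_cast hp
  have hpq := Real.HolderConjugate.conjExponent hp1
  obtain ⟨q, hqdef⟩ : ∃ q, q = Real.conjExponent (p : ℝ) := ⟨_, rfl⟩
  rw [← hqdef] at hpq
  have hexp : ((p : ℝ) * (p + 1)) / (p - 1) = q * (p + 1) := by
    rw [hqdef, Real.conjExponent]
    ring
  have hexp' : ((p : ℝ) - 1) / p = 1 / q := by
    rw [hqdef, Real.conjExponent, one_div_div]
  rw [hexp] at h3 ⊢
  rw [hexp']
  have hd : 0 < b - a := sub_pos.2 hab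
  have hf0 : 0 ≤ᵐ[volume.restrict (Ioc a b)] f := by
    rw [← restrict_Ioo_eq_restrict_Ioc]
    filter_upwards [ae_restrict_mem measurableSet_Ioo] with x hx using hfnonneg x hx
  have hR0 : ∀ x ∈ Ioc a b, 0 ≤ ∫ t in a..x, r t := fun x hx => by
    rw [integral_of_le hx.1.le, integral_Ioc_eq_integral_Ioo]
    exact setIntegral_nonneg measurableSet_Ioo fun t ht =>
      (hrpos t ⟨ht.1, ht.2.trans_le hx.2⟩).le
  have hfq := hfi.rpow_of_le hab.le hpq.symm.nonneg (by nlinarith [hpq.symm.pos]) hf0 h3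
  have hFq := intervalIntegrable_integral_tail_pow_mul_rpow (n := p) hab.le hpq.symm.nonneg
    hf0 hfi hfq
  have hop := integral_integral_tail_pow_mul_rpow_le (n := p) hab hpq.symm.lt.le hf0 hfi h3
  have hFf := hfi.continuousOn_mul
    ((absolutelyContinuousOnInterval_integral_tail hfi).continuousOn.pow p)
  have hR := (hri.absolutelyContinuousOnInterval_intervalIntegral
    (c := a) left_mem_uIcc).continuousOn.intervalIntegrable (μ := volume)
  have hFf0 : 0 ≤ᵐ[volume.restrict (Ioc a b)] fun x => (∫ t in x..b, f t) ^ p * f x := by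
    filter_upwards [hf0, ae_restrict_mem measurableSet_Ioc] with x hx hxm
    exact mul_nonneg
      (pow_nonneg (intervalIntegral_tail_nonneg (Ioc_subset_Icc_self hxm) hf0) p) hx
  have hR0' : 0 ≤ᵐ[volume.restrict (Ioc a b)] fun x => ∫ t in a..x, r t := by
    filter_upwards [ae_restrict_mem measurableSet_Ioc] with x hx using hR0 x hx
  rw [intervalIntegrable_iff_integrableOn_Ioc_of_le hab.le] at hFf hR hFq h2
  have hH := integral_mul_le_Lp_mul_Lq_of_nonneg hpq hR0' hFf0
    (memLp_ofReal_of_integrable_rpow hp0 hR.aestronglyMeasurable hR0'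
      (by simpa only [Real.rpow_natCast] using h2.integrable))
    (memLp_ofReal_of_integrable_rpow hpq.symm.pos hFf.aestronglyMeasurable hFf0 hFq)
  simp only [← integral_of_le hab.le, Real.rpow_natCast] at hH
  have hI : 0 ≤ ∫ x in a..b, f x ^ (q * (p + 1)) := by
    rw [integral_of_le hab.le]
    refine integral_nonneg_of_ae ?_
    filter_upwards [hf0] with x hx using Real.rpow_nonneg hx _
  have hJ : 0 ≤ ∫ x in a..b, ((∫ t in x..b, f t) ^ p * f x) ^ q := by
    rw [integral_of_le hab.le]
    refine integral_nonneg_of_ae ?_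
    filter_upwards [hFf0] with x hx using Real.rpow_nonneg hx _
  have hK : 0 ≤ ∫ x in a..b, (∫ t in a..x, r t) ^ p := by
    rw [integral_of_le hab.le]
    exact setIntegral_nonneg measurableSet_Ioc fun x hx => pow_nonneg (hR0 x hx) p
  have hq' : 0 ≤ 1 / q := hpq.symm.one_div_nonneg
  have hroot := Real.rpow_le_rpow (by positivity) hop hq'
  rw [Real.mul_rpow (by positivity) hJ, Real.mul_rpow (by positivity) hI, ← Real.rpow_mul hd.le,
    mul_assoc, mul_one_div_cancel hpq.symm.ne_zero, mul_one, Real.rpow_natCast] at hroot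
  have hsplit : (p : ℝ) + 1 = (p + 1) ^ (1 / (p : ℝ)) * (p + 1) ^ (1 / q) := by
    rw [← Real.rpow_add (by positivity), one_div, one_div, hpq.inv_add_inv_eq_one, Real.rpow_one]
  rw [integral_mul_integral_tail_pow hri hfi p]
  set K := ∫ x in a..b, (∫ t in a..x, r t) ^ p
  set J := ∫ x in a..b, ((∫ t in x..b, f t) ^ p * f x) ^ q
  set I := ∫ x in a..b, f x ^ (q * (p + 1))
  calc (p + 1) * ∫ x in a..b, (∫ t in a..x, r t) * ((∫ t in x..b, f t) ^ p * f x)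
      ≤ (p + 1) * (K ^ (1 / (p : ℝ)) * J ^ (1 / q)) := by gcongr
    _ = (p + 1) ^ (1 / (p : ℝ)) * K ^ (1 / (p : ℝ)) * ((p + 1) ^ (1 / q) * J ^ (1 / q)) := by
        nth_rewrite 1 [hsplit]
        ring
    _ ≤ (p + 1) ^ (1 / (p : ℝ)) * K ^ (1 / (p : ℝ)) * ((b - a) ^ p * I ^ (1 / q)) := by gcongr
    _ = _ := by ring
end

section
/- Let a < b be real numbers, let r be a positive continuous function on the interval (a,b), and let p ≥ 0 be an integer. Then for every nonnegative measurable function f on (a,b) for which all the integrals below exist and are finite, ∫_a^b r(x)(∫_x^b f(t) dt)^{p+1} dx ≤ (b−a)^p · ∫_a^b R(a,x) f(x)^{p+1} dx. -/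
open MeasureTheory intervalIntegral Set

/-- Jensen's inequality for the power `p + 1` and a finite measure, in `ENNReal`. -/
theorem lintegral_pow_succ_le {α : Type*} [MeasurableSpace α] {μ : Measure α} {g : α → ENNReal}
    (hg : AEMeasurable g μ) (p : ℕ) :
    (∫⁻ t, g t ∂μ) ^ (p + 1) ≤ μ univ ^ p * ∫⁻ t, g t ^ (p + 1) ∂μ := by
  have hq : (0 : ℝ) < (p : ℝ) + 1 := by positivity
  have h := eLpNorm'_le_eLpNorm'_mul_rpow_measure_univ (μ := μ) (f := g) (p := 1) (q := (p : ℝ) + 1)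
    one_pos (by simp) hg.aestronglyMeasurable
  simp only [eLpNorm'_eq_lintegral_enorm, enorm_eq_self, ENNReal.rpow_one, div_one] at h
  calc (∫⁻ t, g t ∂μ) ^ (p + 1)
      = (∫⁻ t, g t ∂μ) ^ ((p : ℝ) + 1) := by rw [← ENNReal.rpow_natCast]; push_cast; rfl
    _ ≤ _ := ENNReal.rpow_le_rpow h hq.le
    _ = μ univ ^ p * ∫⁻ t, g t ^ (p + 1) ∂μ := by
      rw [ENNReal.mul_rpow_of_nonneg _ _ hq.le, ← ENNReal.rpow_mul, ← ENNReal.rpow_mul,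
        one_div_mul_cancel hq.ne', ENNReal.rpow_one, mul_comm,
        show (1 - 1 / ((p : ℝ) + 1)) * (p + 1) = p by field_simp; ring, ENNReal.rpow_natCast]
      congr 1
      refine lintegral_congr fun t => ?_
      rw [← ENNReal.rpow_natCast]; push_cast; rfl

/-- Tonelli's theorem on the triangle `a < x < t < b`. -/
theorem lintegral_mul_lintegral_Ioo_eq {a b : ℝ} {ρ g : ℝ → ENNReal}
    (hρ : AEMeasurable ρ (volume.restrict (Ioo a b)))
    (hg : AEMeasurable g (volume.restrict (Ioo a b))) :
    ∫⁻ x in Ioo a b, ρ x * ∫⁻ t in Ioo x b, g t =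
      ∫⁻ t in Ioo a b, (∫⁻ x in Ioo a t, ρ x) * g t := by
  have hl : ∀ x ∈ Ioo a b, ρ x * ∫⁻ t in Ioo x b, g t =
      ∫⁻ t in Ioo a b, {z : ℝ × ℝ | z.1 < z.2}.indicator (fun z => ρ z.1 * g z.2) (x, t) := by
    intro x hx
    have hs : Ioo x b = Ioi x ∩ Ioo a b := by
      ext t; simp only [mem_Ioo, mem_inter_iff, mem_Ioi]
      exact ⟨fun h => ⟨h.1, hx.1.trans h.1, h.2⟩, fun h => ⟨h.1, h.2.2⟩⟩
    rw [hs, ← Measure.restrict_restrict measurableSet_Ioi,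
      ← lintegral_const_mul'' _ hg.restrict, ← lintegral_indicator measurableSet_Ioi]
    rfl
  have hr : ∀ t ∈ Ioo a b, (∫⁻ x in Ioo a t, ρ x) * g t =
      ∫⁻ x in Ioo a b, {z : ℝ × ℝ | z.1 < z.2}.indicator (fun z => ρ z.1 * g z.2) (x, t) := by
    intro t ht
    have hs : Ioo a t = Iio t ∩ Ioo a b := by
      ext x; simp only [mem_Ioo, mem_inter_iff, mem_Iio]
      exact ⟨fun h => ⟨h.2, h.1, h.2.trans ht.2⟩, fun h => ⟨h.2.1, h.1⟩⟩
    rw [hs, ← Measure.restrict_restrict measurableSet_Iio,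
      ← lintegral_mul_const'' _ hρ.restrict, ← lintegral_indicator measurableSet_Iio]
    rfl
  rw [setLIntegral_congr_fun measurableSet_Ioo hl, setLIntegral_congr_fun measurableSet_Ioo hr]
  refine lintegral_lintegral_swap ?_
  exact (hρ.comp_fst.mul hg.comp_snd).indicator (measurableSet_lt measurable_fst measurable_snd)

/-- The interval integral of a function nonnegative on `(a, b)`, as a lower integral. -/
theorem ofReal_intervalIntegral_eq_lintegral_Ioo {a b : ℝ} (hab : a ≤ b) {f : ℝ → ℝ}
    (hf : IntervalIntegrable f volume a b) (h0 : ∀ x ∈ Ioo a b, 0 ≤ f x) :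
    ENNReal.ofReal (∫ x in a..b, f x) = ∫⁻ x in Ioo a b, ENNReal.ofReal (f x) := by
  rw [integral_of_le hab, integral_Ioc_eq_integral_Ioo]
  exact ofReal_integral_eq_lintegral_ofReal
    ((intervalIntegrable_iff_integrableOn_Ioo_of_le hab).1 hf)
    (ae_restrict_of_forall_mem measurableSet_Ioo h0)

/-- Theorem 2.19: For positive continuous `r` on `(a,b)`, an integer `p ≥ 0`, and
nonnegative measurable `f` (all integrals existing and finite),
`∫_a^b r(x)(∫_x^b f)^(p+1) dx ≤ (b−a)^p · ∫_a^b R(a,x) f(x)^(p+1) dx`,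
where `R(a,x) = ∫_a^x r(t) dt`. -/
theorem hardy_type_thm_2_19 (a b : ℝ) (hab : a < b) (p : ℕ) (r f : ℝ → ℝ)
    (hr : ContinuousOn r (Ioo a b)) (hrpos : ∀ x ∈ Ioo a b, 0 < r x)
    (hfmeas : Measurable f) (hfnonneg : ∀ x ∈ Ioo a b, 0 ≤ f x)
    (hfi : IntervalIntegrable f volume a b)
    (hri : IntervalIntegrable r volume a b)
    (h1 : IntervalIntegrable (fun x => r x * (∫ t in x..b, f t) ^ (p + 1)) volume a b)
    (h2 : IntervalIntegrable (fun x => (∫ t in a..x, r t) * f x ^ (p + 1)) volume a b) :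
    ∫ x in a..b, r x * (∫ t in x..b, f t) ^ (p + 1) ≤
      (b - a) ^ p * ∫ x in a..b, (∫ t in a..x, r t) * f x ^ (p + 1) := by
  have hF : ∀ x ∈ Ioo a b, 0 ≤ ∫ t in x..b, f t := fun x hx => by
    rw [integral_of_le hx.2.le, integral_Ioc_eq_integral_Ioo]
    exact setIntegral_nonneg measurableSet_Ioo fun t ht => hfnonneg t ⟨hx.1.trans ht.1, ht.2⟩
  have hR : ∀ x ∈ Ioo a b, 0 ≤ ∫ t in a..x, r t := fun x hx => by
    rw [integral_of_le hx.1.le, integral_Ioc_eq_integral_Ioo]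
    exact setIntegral_nonneg measurableSet_Ioo fun t ht => (hrpos t ⟨ht.1, ht.2.trans hx.2⟩).le
  have hFe : ∀ x ∈ Ioo a b,
      ENNReal.ofReal (∫ t in x..b, f t) = ∫⁻ t in Ioo x b, ENNReal.ofReal (f t) := fun x hx =>
    ofReal_intervalIntegral_eq_lintegral_Ioo hx.2.le
      (hfi.mono_set (uIcc_subset_uIcc_right (by rw [uIcc_of_le hab.le]; exact Ioo_subset_Icc_self hx)))
      fun t ht => hfnonneg t ⟨hx.1.trans ht.1, ht.2⟩
  have hRe : ∀ x ∈ Ioo a b,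
      ENNReal.ofReal (∫ t in a..x, r t) = ∫⁻ t in Ioo a x, ENNReal.ofReal (r t) := fun x hx =>
    ofReal_intervalIntegral_eq_lintegral_Ioo hx.1.le
      (hri.mono_set (uIcc_subset_uIcc_left (by rw [uIcc_of_le hab.le]; exact Ioo_subset_Icc_self hx)))
      fun t ht => (hrpos t ⟨ht.1, ht.2.trans hx.2⟩).le
  have hK : 0 ≤ (b - a) ^ p := pow_nonneg (sub_nonneg.2 hab.le) p
  have hg0 : ∀ x ∈ Ioo a b, 0 ≤ (∫ t in a..x, r t) * f x ^ (p + 1) := fun x hx =>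
    mul_nonneg (hR x hx) (pow_nonneg (hfnonneg x hx) _)
  have hI : 0 ≤ ∫ x in a..b, (∫ t in a..x, r t) * f x ^ (p + 1) := by
    rw [integral_of_le hab.le, integral_Ioc_eq_integral_Ioo]
    exact setIntegral_nonneg measurableSet_Ioo hg0
  have hfm : Measurable fun t => ENNReal.ofReal (f t) := hfmeas.ennreal_ofReal
  rw [← ENNReal.ofReal_le_ofReal_iff (mul_nonneg hK hI), ENNReal.ofReal_mul hK,
    ofReal_intervalIntegral_eq_lintegral_Ioo hab.le h1 fun x hx =>
      mul_nonneg (hrpos x hx).le (pow_nonneg (hF x hx) _),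
    ofReal_intervalIntegral_eq_lintegral_Ioo hab.le h2 hg0]
  calc ∫⁻ x in Ioo a b, ENNReal.ofReal (r x * (∫ t in x..b, f t) ^ (p + 1))
      ≤ ∫⁻ x in Ioo a b, ENNReal.ofReal ((b - a) ^ p) *
          (ENNReal.ofReal (r x) * ∫⁻ t in Ioo x b, ENNReal.ofReal (f t) ^ (p + 1)) := by
        refine setLIntegral_mono' measurableSet_Ioo fun x hx => ?_
        rw [ENNReal.ofReal_mul (hrpos x hx).le, ENNReal.ofReal_pow (hF x hx), hFe x hx,
          mul_left_comm]
        refine mul_le_mul_right ((lintegral_pow_succ_le hfm.aemeasurable p).trans ?_) _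
        refine mul_le_mul_left ?_ _
        rw [Measure.restrict_apply_univ, Real.volume_Ioo,
          ENNReal.ofReal_pow (sub_nonneg.2 hab.le)]
        exact pow_le_pow_left' (ENNReal.ofReal_le_ofReal (by linarith [hx.1])) p
    _ = ENNReal.ofReal ((b - a) ^ p) * ∫⁻ x in Ioo a b,
          ENNReal.ofReal (r x) * ∫⁻ t in Ioo x b, ENNReal.ofReal (f t) ^ (p + 1) :=
        lintegral_const_mul' _ _ ENNReal.ofReal_ne_top
    _ = ENNReal.ofReal ((b - a) ^ p) * ∫⁻ x in Ioo a b,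
          (∫⁻ t in Ioo a x, ENNReal.ofReal (r t)) * ENNReal.ofReal (f x) ^ (p + 1) := by
        rw [lintegral_mul_lintegral_Ioo_eq
          (hr.aemeasurable measurableSet_Ioo).ennreal_ofReal (hfm.pow_const _).aemeasurable]
    _ = ENNReal.ofReal ((b - a) ^ p) * ∫⁻ x in Ioo a b,
          ENNReal.ofReal ((∫ t in a..x, r t) * f x ^ (p + 1)) := by
        congr 1
        refine setLIntegral_congr_fun measurableSet_Ioo fun x hx => ?_
        rw [ENNReal.ofReal_mul (hR x hx), hRe x hx, ENNReal.ofReal_pow (hfnonneg x hx)]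
end
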